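/- arXiv:2508.11208 — 2 statements merged into one kernel-verified Lean document; each statement's English description precedes it below -/
import Mathlib

section
/- Let E ⊆ ℝⁿ be a measurable set and let u := χ_E − χ_{ℝⁿ∖E} (so u(x) = 1 for x ∈ E and u(x) = −1 otherwise). Suppose D(u,Ω) < ∞. Then for a.e. x ∈ Ω the integral H(x) := ∫_{ℝⁿ} |u(x)−u(y)|²/|x−y|^{n+2s} dy is finite, and for every φ ∈ C_c^∞(Ω) one has B(u,φ) = ∫_Ω ( (1/2) ∫_{ℝⁿ} |u(x)−u(y)|²/|x−y|^{n+2s} dy ) u(x) φ(x) dx. That is, weakly in Ω, (−Δ)^s u(x) = ((1/2)∫_{ℝⁿ} |u(x)−u(y)|²/|x−y|^{n+2s} dy) u(x) (up to the normalizing constant c_{n,s}). -/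
open MeasureTheory Filter ENNReal
open scoped Classical

noncomputable section

/-- The Euclidean space `ℝⁿ`. -/
abbrev Euc (n : ℕ) := EuclideanSpace ℝ (Fin n)

/-- The Gagliardo `Ω`-energy
`D(u,Ω) := (∫_Ω∫_Ω + 2∫_Ω∫_{ℝⁿ∖Ω}) |u(x)−u(y)|²/|x−y|^{n+2s} dx dy`, valued in `[0,∞]`. -/
noncomputable def gagD (n : ℕ) (s : ℝ) (Ω : Set (Euc n)) (u : Euc n → ℝ) : ℝ≥0∞ :=
  (∫⁻ x in Ω, ∫⁻ y in Ω, ENNReal.ofReal (|u x - u y| ^ 2 / ‖x - y‖ ^ ((n : ℝ) + 2 * s)))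
    + 2 * ∫⁻ x in Ω, ∫⁻ y in Ωᶜ, ENNReal.ofReal (|u x - u y| ^ 2 / ‖x - y‖ ^ ((n : ℝ) + 2 * s))

/-- The bilinear pairing
`B(u,φ) := (1/2)(∫_Ω∫_Ω + 2∫_Ω∫_{ℝⁿ∖Ω}) (u(x)−u(y))(φ(x)−φ(y))/|x−y|^{n+2s} dx dy`,
the weak form of `(−Δ)^s` on `Ω` (up to the constant `c_{n,s}`). -/
noncomputable def gagB (n : ℕ) (s : ℝ) (Ω : Set (Euc n)) (u φ : Euc n → ℝ) : ℝ :=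
  (1 / 2) * ((∫ x in Ω, ∫ y in Ω, (u x - u y) * (φ x - φ y) / ‖x - y‖ ^ ((n : ℝ) + 2 * s))
    + 2 * ∫ x in Ω, ∫ y in Ωᶜ, (u x - u y) * (φ x - φ y) / ‖x - y‖ ^ ((n : ℝ) + 2 * s))

section SymmetricKernel

variable {α : Type*} [MeasurableSpace α] {μ : Measure α}

/-- A measurable nonnegative kernel with finite iterated `lintegral`, multiplied by a bounded
measurable function of the first variable, is integrable on the product. -/
lemma integrable_kernel_mul_fst {ν : Measure α} [SFinite ν] {g : α → α → ℝ}
    (hg : Measurable (Function.uncurry g)) (hg0 : ∀ x y, 0 ≤ g x y)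
    (hfin : ∫⁻ x, ∫⁻ y, ENNReal.ofReal (g x y) ∂ν ∂μ < ⊤)
    {v : α → ℝ} (hv : Measurable v) {C : ℝ} (hC : ∀ x, |v x| ≤ C) :
    Integrable (fun z : α × α => g z.1 z.2 * v z.1) (μ.prod ν) := by
  have hint : Integrable (fun z : α × α => g z.1 z.2) (μ.prod ν) := by
    refine ⟨hg.aestronglyMeasurable, ?_⟩
    rw [hasFiniteIntegral_iff_ofReal (ae_of_all _ fun z : α × α => hg0 z.1 z.2)]
    exact (lintegral_prod _ hg.ennreal_ofReal.aemeasurable).trans_lt hfin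
  exact hint.mul_bdd (hv.comp measurable_fst).aestronglyMeasurable
    (ae_of_all _ fun z => hC z.1)

/-- Almost every slice over `Ω` of a kernel with finite energy has finite total mass. -/
lemma ae_lintegral_kernel_lt_top [SFinite μ] {Ω : Set α} (hΩ : MeasurableSet Ω) {g : α → α → ℝ}
    (hg : Measurable (Function.uncurry g))
    (hfin : ∫⁻ x in Ω, ∫⁻ y in Ω, ENNReal.ofReal (g x y) ∂μ ∂μ < ⊤)
    (hfin' : ∫⁻ x in Ω, ∫⁻ y in Ωᶜ, ENNReal.ofReal (g x y) ∂μ ∂μ < ⊤) :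
    ∀ᵐ x ∂(μ.restrict Ω), ∫⁻ y, ENNReal.ofReal (g x y) ∂μ < ⊤ := by
  filter_upwards [ae_lt_top hg.ennreal_ofReal.lintegral_prod_right' hfin.ne,
    ae_lt_top hg.ennreal_ofReal.lintegral_prod_right' hfin'.ne] with x h₁ h₂
  rw [← lintegral_add_compl _ hΩ]
  exact ENNReal.add_lt_top.2 ⟨h₁, h₂⟩

/-- Symmetrization: for a symmetric nonnegative kernel `g` of finite `Ω`-energy and a bounded
function `v` vanishing outside `Ω`, the energy pairing of `g` with `v x + v y` reduces to
integrating `v` against the total mass of the slices of `g`. -/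
lemma integral_kernel_mul_add [SFinite μ] {Ω : Set α} (hΩ : MeasurableSet Ω) {g : α → α → ℝ}
    (hg : Measurable (Function.uncurry g)) (hg0 : ∀ x y, 0 ≤ g x y)
    (hsymm : ∀ x y, g x y = g y x)
    (hfin : ∫⁻ x in Ω, ∫⁻ y in Ω, ENNReal.ofReal (g x y) ∂μ ∂μ < ⊤)
    (hfin' : ∫⁻ x in Ω, ∫⁻ y in Ωᶜ, ENNReal.ofReal (g x y) ∂μ ∂μ < ⊤)
    {v : α → ℝ} (hv : Measurable v) {C : ℝ} (hC : ∀ x, |v x| ≤ C) (hv0 : ∀ x ∉ Ω, v x = 0) :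
    (∫ x in Ω, ∫ y in Ω, g x y * (v x + v y) ∂μ ∂μ)
        + 2 * ∫ x in Ω, ∫ y in Ωᶜ, g x y * (v x + v y) ∂μ ∂μ
      = 2 * ∫ x in Ω, (∫⁻ y, ENNReal.ofReal (g x y) ∂μ).toReal * v x ∂μ := by
  have hI := integrable_kernel_mul_fst hg hg0 hfin hv hC
  have hI' := integrable_kernel_mul_fst hg hg0 hfin' hv hC
  have hinner : ∫ x in Ω, ∫ y in Ω, g x y * (v x + v y) ∂μ ∂μ
      = 2 * ∫ x in Ω, ∫ y in Ω, g x y * v x ∂μ ∂μ := by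
    have hsplit : ∀ x y, g x y * (v x + v y) = g x y * v x + g y x * v y := fun x y => by
      rw [hsymm y x, mul_add]
    simp_rw [hsplit]
    refine (integral_integral_add hI hI.swap).trans ?_
    rw [two_mul]
    congr 1
    exact (integral_integral_swap (f := fun x y => g x y * v x) hI).symm
  have houter : ∫ x in Ω, ∫ y in Ωᶜ, g x y * (v x + v y) ∂μ ∂μ
      = ∫ x in Ω, ∫ y in Ωᶜ, g x y * v x ∂μ ∂μ := by
    refine integral_congr_ae (ae_of_all _ fun x => ?_)
    refine setIntegral_congr_fun hΩ.compl fun y hy => ?_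
    simp only [hv0 y hy, add_zero]
  rw [hinner, houter, ← mul_add, ← integral_add hI.integral_prod_left hI'.integral_prod_left]
  congr 1
  refine integral_congr_ae ?_
  filter_upwards [ae_lintegral_kernel_lt_top hΩ hg hfin hfin'] with x hx
  have hgx : Measurable (g x) := hg.of_uncurry_left
  have hgi : Integrable (g x) μ :=
    ⟨hgx.aestronglyMeasurable, (hasFiniteIntegral_iff_ofReal (ae_of_all _ (hg0 x))).2 hx⟩
  rw [integral_add_compl hΩ (hgi.mul_const _), integral_mul_const,
    integral_eq_lintegral_of_nonneg_ae (ae_of_all _ (hg0 x)) hgx.aestronglyMeasurable]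

end SymmetricKernel


/-- For `u = χ_E − χ_{ℝⁿ∖E}` with finite Gagliardo `Ω`-energy, the integral
`H(x) = ∫_{ℝⁿ} |u(x)−u(y)|²/|x−y|^{n+2s} dy` is finite for a.e. `x ∈ Ω`, and weakly in `Ω`
one has `(−Δ)^s u(x) = ((1/2)∫_{ℝⁿ} |u(x)−u(y)|²/|x−y|^{n+2s} dy) u(x)`. -/
theorem fracLaplacian_of_pm_one_indicator
    (n : ℕ) (hn : 1 ≤ n) (s : ℝ) (hs0 : 0 < s) (hs : s < 1 / 2)
    (Ω : Set (Euc n)) (hΩo : IsOpen Ω) (hΩne : Ω.Nonempty) (hΩb : Bornology.IsBounded Ω)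
    (E : Set (Euc n)) (hE : MeasurableSet E)
    (u : Euc n → ℝ) (hu : u = fun x => if x ∈ E then 1 else -1)
    (huD : gagD n s Ω u < ⊤) :
    (∀ᵐ x ∂(volume.restrict Ω),
        (∫⁻ y : Euc n, ENNReal.ofReal (|u x - u y| ^ 2 / ‖x - y‖ ^ ((n : ℝ) + 2 * s))) < ⊤)
    ∧ ∀ φ : Euc n → ℝ, ContDiff ℝ (⊤ : ℕ∞) φ → HasCompactSupport φ → tsupport φ ⊆ Ω →
        gagB n s Ω u φ
          = ∫ x in Ω,
              ((1 / 2) * (∫⁻ y : Euc n,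
                  ENNReal.ofReal (|u x - u y| ^ 2 / ‖x - y‖ ^ ((n : ℝ) + 2 * s))).toReal)
                * u x * φ x := by
  have hum : Measurable u := by
    rw [hu]
    exact Measurable.ite hE measurable_const measurable_const
  have hu1 : ∀ x, u x = 1 ∨ u x = -1 := fun x => by
    rw [hu]
    by_cases hx : x ∈ E <;> simp [hx]
  set g : Euc n → Euc n → ℝ :=
    fun x y => |u x - u y| ^ 2 / ‖x - y‖ ^ ((n : ℝ) + 2 * s) with hg_def
  have hg : Measurable (Function.uncurry g) := by
    have h₁ : Measurable fun z : Euc n × Euc n => |u z.1 - u z.2| ^ 2 := by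
      simp_rw [sq_abs]
      exact ((hum.comp measurable_fst).sub (hum.comp measurable_snd)).pow_const 2
    exact h₁.div ((measurable_fst.sub measurable_snd).norm.pow_const _)
  have hg0 : ∀ x y, 0 ≤ g x y := fun x y => by positivity
  have hsymm : ∀ x y, g x y = g y x := fun x y => by
    simp only [hg_def, abs_sub_comm (u x), norm_sub_rev x]
  have hfin : ∫⁻ x in Ω, ∫⁻ y in Ω, ENNReal.ofReal (g x y) < ⊤ :=
    (ENNReal.add_lt_top.1 huD).1
  have hfin' : ∫⁻ x in Ω, ∫⁻ y in Ωᶜ, ENNReal.ofReal (g x y) < ⊤ :=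
    ENNReal.lt_top_of_mul_ne_top_right (ENNReal.add_lt_top.1 huD).2.ne two_ne_zero
  refine ⟨ae_lintegral_kernel_lt_top hΩo.measurableSet hg hfin hfin', fun φ hφ hφc hφΩ => ?_⟩
  obtain ⟨C, hC⟩ := hφc.exists_bound_of_continuous hφ.continuous
  have hvC : ∀ x, |u x * φ x| ≤ C := fun x => by
    rcases hu1 x with h | h <;> simpa [h] using hC x
  have hv0 : ∀ x ∉ Ω, u x * φ x = 0 := fun x hx => by
    rw [image_eq_zero_of_notMem_tsupport fun h => hx (hφΩ h), mul_zero]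
  have hpair : ∀ x y, (u x - u y) * (φ x - φ y) / ‖x - y‖ ^ ((n : ℝ) + 2 * s)
      = (1 / 2) * (g x y * (u x * φ x + u y * φ y)) := fun x y => by
    have hnum : (u x - u y) * (φ x - φ y)
        = (1 / 2) * (|u x - u y| ^ 2 * (u x * φ x + u y * φ y)) := by
      rw [sq_abs]
      rcases hu1 x with hx | hx <;> rcases hu1 y with hy | hy <;> rw [hx, hy] <;> ring
    rw [hnum]
    ring
  have key := integral_kernel_mul_add hΩo.measurableSet hg hg0 hsymm hfin hfin'
    (hum.mul hφ.continuous.measurable) hvC hv0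
  simp only [Pi.mul_apply] at key
  simp_rw [gagB, hpair, integral_const_mul, mul_assoc, integral_const_mul]
  linarith
end
end

section
/- Let u : ℝⁿ → ℝ be measurable with u ∈ L^∞(ℝⁿ), and suppose that for every compact set K ⊂ ℝⁿ one has ∫_K∫_K |u(x)−u(y)|²/|x−y|^{n+2s} dx dy < ∞. Then D(u,Ω) < ∞, i.e. (∫_Ω∫_Ω + 2∫_Ω∫_{ℝⁿ∖Ω}) |u(x)−u(y)|²/|x−y|^{n+2s} dx dy < ∞. In other words, H^s_loc(ℝⁿ) ∩ L^∞(ℝⁿ) ⊂ Ĥ^s(Ω). -/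
open MeasureTheory Filter ENNReal

noncomputable section

/-- For `‖x‖ ≤ R` and `‖y‖ > 2 * R` with `1 ≤ R`, the Gagliardo integrand of a function bounded
by `M` is at most an integrable function of `y` alone. -/
theorem gagliardo_integrand_le_of_far {E : Type*} [NormedAddCommGroup E] {r R M : ℝ}
    (hr : 0 ≤ r) (hR : 1 ≤ R) {u : E → ℝ} (hM : ∀ x, |u x| ≤ M) {x y : E}
    (hx : ‖x‖ ≤ R) (hy : 2 * R < ‖y‖) :
    |u x - u y| ^ 2 / ‖x - y‖ ^ r ≤ (2 * M) ^ 2 * 4 ^ r * (1 + ‖y‖) ^ (-r) := by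
  have hxy : (1 + ‖y‖) / 4 ≤ ‖x - y‖ := by
    have := norm_sub_norm_le y x
    rw [norm_sub_rev] at this
    linarith
  have hpos : 0 < 1 + ‖y‖ := by positivity
  have hu : |u x - u y| ≤ 2 * M := by
    have := abs_sub (u x) (u y)
    linarith [hM x, hM y]
  calc |u x - u y| ^ 2 / ‖x - y‖ ^ r
      ≤ (2 * M) ^ 2 / ((1 + ‖y‖) / 4) ^ r := by gcongr
    _ = (2 * M) ^ 2 * 4 ^ r * (1 + ‖y‖) ^ (-r) := by
      rw [Real.div_rpow hpos.le (by norm_num), Real.rpow_neg hpos.le]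
      field_simp

/-- `H^s_loc(ℝⁿ) ∩ L^∞(ℝⁿ) ⊂ Ĥ^s(Ω)`: a bounded measurable function whose Gagliardo
seminorm is finite on every compact set has finite Gagliardo `Ω`-energy. -/
theorem HsLoc_inter_Linfty_subset_hatHs
    (n : ℕ) (hn : 1 ≤ n) (s : ℝ) (hs0 : 0 < s) (hs : s < 1 / 2)
    (Ω : Set (Euc n)) (hΩo : IsOpen Ω) (hΩne : Ω.Nonempty) (hΩb : Bornology.IsBounded Ω)
    (u : Euc n → ℝ) (hu : Measurable u) (hbd : ∃ M : ℝ, ∀ x, |u x| ≤ M)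
    (hloc : ∀ K : Set (Euc n), IsCompact K →
      (∫⁻ x in K, ∫⁻ y in K,
        ENNReal.ofReal (|u x - u y| ^ 2 / ‖x - y‖ ^ ((n : ℝ) + 2 * s))) < ⊤) :
    gagD n s Ω u < ⊤ := by
  obtain ⟨M, hM⟩ := hbd
  obtain ⟨R₀, hR₀⟩ := hΩb.exists_norm_le
  set R := max R₀ 1
  have hR1 : 1 ≤ R := le_max_right _ _
  have hR : ∀ x ∈ Ω, ‖x‖ ≤ R := fun x hx => (hR₀ x hx).trans (le_max_left _ _)
  set r : ℝ := (n : ℝ) + 2 * s with hr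
  set f : Euc n → Euc n → ℝ≥0∞ := fun x y =>
    ENNReal.ofReal (|u x - u y| ^ 2 / ‖x - y‖ ^ r) with hf
  set K : Set (Euc n) := Metric.closedBall 0 (2 * R) with hK
  have hKmeas : MeasurableSet K := Metric.isClosed_closedBall.measurableSet
  have hΩK : Ω ⊆ K := fun x hx => by
    rw [hK, mem_closedBall_zero_iff]
    linarith [hR x hx]
  have hKfin : (∫⁻ x in K, ∫⁻ y in K, f x y) < ⊤ := hloc K (isCompact_closedBall _ _)
  have hΩK_le : (∫⁻ x in Ω, ∫⁻ y in K, f x y) ≤ ∫⁻ x in K, ∫⁻ y in K, f x y :=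
    lintegral_mono_set hΩK
  have hΩΩ : (∫⁻ x in Ω, ∫⁻ y in Ω, f x y) < ⊤ :=
    ((lintegral_mono fun x => lintegral_mono_set hΩK).trans hΩK_le).trans_lt hKfin
  set C : ℝ≥0∞ := ∫⁻ y : Euc n, ENNReal.ofReal ((2 * M) ^ 2 * 4 ^ r * (1 + ‖y‖) ^ (-r)) with hC
  have hCfin : C < ⊤ := by
    have hconst : 0 ≤ (2 * M) ^ 2 * (4 : ℝ) ^ r := by positivity
    simp_rw [hC, ENNReal.ofReal_mul hconst]
    rw [lintegral_const_mul' _ _ ofReal_ne_top]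
    refine mul_lt_top ofReal_lt_top (finite_integral_one_add_norm ?_)
    rw [finrank_euclideanSpace_fin]
    linarith
  have hfar : ∀ x ∈ Ω, (∫⁻ y in Ωᶜ, f x y) ≤ (∫⁻ y in K, f x y) + C := fun x hx =>
    calc (∫⁻ y in Ωᶜ, f x y) ≤ ∫⁻ y, f x y := setLIntegral_le_lintegral _ _
      _ = (∫⁻ y in K, f x y) + ∫⁻ y in Kᶜ, f x y := (lintegral_add_compl _ hKmeas).symm
      _ ≤ (∫⁻ y in K, f x y) + C := by
        gcongr
        refine (setLIntegral_mono' hKmeas.compl fun y hy => ?_).trans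
          (setLIntegral_le_lintegral Kᶜ _)
        rw [hK, Set.mem_compl_iff, mem_closedBall_zero_iff, not_le] at hy
        exact ENNReal.ofReal_le_ofReal
          (gagliardo_integrand_le_of_far (by positivity) hR1 hM (hR x hx) hy)
  have hΩc : (∫⁻ x in Ω, ∫⁻ y in Ωᶜ, f x y) < ⊤ :=
    calc (∫⁻ x in Ω, ∫⁻ y in Ωᶜ, f x y)
        ≤ ∫⁻ x in Ω, ((∫⁻ y in K, f x y) + C) := setLIntegral_mono' hΩo.measurableSet hfar
      _ = (∫⁻ x in Ω, ∫⁻ y in K, f x y) + C * volume Ω := by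
        rw [lintegral_add_right _ measurable_const, setLIntegral_const]
      _ < ⊤ := add_lt_top.2 ⟨hΩK_le.trans_lt hKfin, mul_lt_top hCfin hΩb.measure_lt_top⟩
  exact add_lt_top.2 ⟨hΩΩ, mul_lt_top (by simp) hΩc⟩
end
end
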